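/- For every integer n ≥ 1, ψ_n(X,Y) ≠ 0, and the Laurent series ψ_{2n}(X,Y)/ψ_n(X,Y) ∈ K((t)) is nonzero, has order −3n², and has leading coefficient 2·(−1)ⁿ. (Equivalently, ψ_{2n}/(2ψ_n) has Laurent expansion at infinity with leading term (−1)ⁿ·t^{−3n²}.) -/

import Mathlib

open HahnSeries

/-- `f = c tᵏ + O(tᵏ⁺¹)`; the coefficient `c` is allowed to vanish. -/
def HasLeadingTerm {K : Type*} [Field K] (f : LaurentSeries K) (k : ℤ) (c : K) : Prop :=
  ∃ p : PowerSeries K, PowerSeries.constantCoeff p = c ∧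
    f = HahnSeries.single k (1 : K) * (p : LaurentSeries K)

namespace HasLeadingTerm

variable {K : Type*} [Field K] {f g : LaurentSeries K} {k l : ℤ} {c d : K}

theorem zero (k : ℤ) : HasLeadingTerm (0 : LaurentSeries K) k 0 :=
  ⟨0, by simp, by simp⟩

theorem C (c : K) : HasLeadingTerm (HahnSeries.C c : LaurentSeries K) 0 c :=
  ⟨PowerSeries.C c, by simp, by simp⟩

theorem add (hf : HasLeadingTerm f k c) (hg : HasLeadingTerm g k d) :
    HasLeadingTerm (f + g) k (c + d) := by
  obtain ⟨p, rfl, rfl⟩ := hf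
  obtain ⟨q, rfl, rfl⟩ := hg
  exact ⟨p + q, by simp, by simp [mul_add]⟩

theorem sub (hf : HasLeadingTerm f k c) (hg : HasLeadingTerm g k d) :
    HasLeadingTerm (f - g) k (c - d) := by
  obtain ⟨p, rfl, rfl⟩ := hf
  obtain ⟨q, rfl, rfl⟩ := hg
  exact ⟨p - q, by simp, by simp [mul_sub]⟩

theorem mul (hf : HasLeadingTerm f k c) (hg : HasLeadingTerm g l d) :
    HasLeadingTerm (f * g) (k + l) (c * d) := by
  obtain ⟨p, rfl, rfl⟩ := hf
  obtain ⟨q, rfl, rfl⟩ := hg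
  refine ⟨p * q, by simp, ?_⟩
  rw [mul_mul_mul_comm, HahnSeries.single_mul_single, mul_one, PowerSeries.coe_mul]

theorem pow (hf : HasLeadingTerm f k c) (n : ℕ) : HasLeadingTerm (f ^ n) (n * k) (c ^ n) := by
  induction n with
  | zero => simpa using C (1 : K)
  | succ n ih =>
    rw [pow_succ, pow_succ, Nat.cast_succ, add_mul, one_mul]
    exact ih.mul hf

/-- A series of strictly larger order does not contribute to the term of degree `l`. -/
theorem of_lt (hf : HasLeadingTerm f k c) (h : l < k) : HasLeadingTerm f l 0 := by
  obtain ⟨p, rfl, rfl⟩ := hf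
  obtain ⟨n, hn⟩ := Int.eq_ofNat_of_zero_le (sub_nonneg.2 h.le)
  refine ⟨PowerSeries.X ^ n * p, ?_, ?_⟩
  · have : n ≠ 0 := by omega
    simp [this]
  · rw [PowerSeries.coe_mul, ← mul_assoc, PowerSeries.coe_pow, PowerSeries.coe_X,
      HahnSeries.single_pow, HahnSeries.single_mul_single, one_pow, one_mul,
      show l + n • (1 : ℤ) = k by rw [nsmul_one]; linarith]

theorem coeff_eq (hf : HasLeadingTerm f k c) : f.coeff k = c := by
  obtain ⟨p, rfl, rfl⟩ := hf
  have := HahnSeries.coeff_single_mul_add (r := (1 : K)) (x := (p : LaurentSeries K))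
    (a := 0) (b := k)
  rw [zero_add, one_mul] at this
  rw [this]
  simpa using LaurentSeries.coeff_coe_powerSeries p 0

theorem ne_zero (hf : HasLeadingTerm f k c) (hc : c ≠ 0) : f ≠ 0 := by
  rintro rfl
  exact hc (by simpa using hf.coeff_eq.symm)

theorem order_eq (hf : HasLeadingTerm f k c) (hc : c ≠ 0) : f.order = k := by
  apply le_antisymm
  · exact HahnSeries.order_le_of_coeff_ne_zero (by rwa [hf.coeff_eq])
  · by_contra! h
    exact HahnSeries.coeff_order_eq_zero.not.2 (hf.ne_zero hc) (hf.of_lt h).coeff_eq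

theorem div (hf : HasLeadingTerm f k c) (hg : HasLeadingTerm g l d) (hd : d ≠ 0) :
    HasLeadingTerm (f / g) (k - l) (c / d) := by
  have hg0 := hg.ne_zero hd
  obtain ⟨p, rfl, rfl⟩ := hf
  obtain ⟨q, rfl, rfl⟩ := hg
  refine ⟨p * q⁻¹, by simp [div_eq_mul_inv], ?_⟩
  rw [div_eq_iff hg0, mul_mul_mul_comm, HahnSeries.single_mul_single, ← PowerSeries.coe_mul,
    mul_assoc, PowerSeries.inv_mul_cancel _ hd]
  simp

theorem of_single_mul {n : ℕ}
    (h : ∃ p : PowerSeries K, HahnSeries.single (1 : ℤ) (1 : K) ^ n * f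
      = HahnSeries.C c + HahnSeries.single (1 : ℤ) (1 : K) * (p : LaurentSeries K)) :
    HasLeadingTerm f (-n) c := by
  obtain ⟨p, hp⟩ := h
  refine ⟨PowerSeries.C c + PowerSeries.X * p, by simp, ?_⟩
  rw [PowerSeries.coe_add, PowerSeries.coe_mul, PowerSeries.coe_X, PowerSeries.coe_C, ← hp,
    HahnSeries.single_pow, ← mul_assoc, HahnSeries.single_mul_single]
  simp

theorem congr (hf : HasLeadingTerm f k c) (hk : k = l) (hc : c = d) : HasLeadingTerm f l d :=
  hk ▸ hc ▸ hf

/-- One step of Horner's scheme does not change the leading coefficient. -/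
theorem mul_add_C (hg : HasLeadingTerm g k c) (hf : HasLeadingTerm f l 1) (h : k + l < 0) (e : K) :
    HasLeadingTerm (g * f + HahnSeries.C e) (k + l) c :=
  ((hg.mul hf).add ((C e).of_lt h)).congr rfl (by simp)

end HasLeadingTerm

/-- Leading terms propagate along the division polynomial recurrences. -/
theorem hasLeadingTerm_of_division_recurrence {K : Type*} [Field K] [CharZero K]
    {ψ : ℕ → LaurentSeries K}
    (h₀ : ψ 0 = 0) (h₁ : ψ 1 = 1)
    (h₂ : HasLeadingTerm (ψ 2) (-3) (-2))
    (h₃ : HasLeadingTerm (ψ 3) (-8) 3)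
    (h₄ : HasLeadingTerm (ψ 4) (-15) (-4))
    (hodd : ∀ m : ℕ, 2 ≤ m →
      ψ (2 * m + 1) = ψ (m + 2) * ψ m ^ 3 - ψ (m - 1) * ψ (m + 1) ^ 3)
    (heven : ∀ m : ℕ, 2 ≤ m →
      ψ 2 * ψ (2 * m) = ψ m * (ψ (m + 2) * ψ (m - 1) ^ 2 - ψ (m - 2) * ψ (m + 1) ^ 2)) (n : ℕ) :
    HasLeadingTerm (ψ n) (1 - (n : ℤ) ^ 2) ((-1) ^ (n + 1) * n) := by
  induction n using Nat.strong_induction_on with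
  | _ n ih =>
  have h2 : (-2 : K) ≠ 0 := by norm_num
  obtain hn | hn := lt_or_ge n 5
  · interval_cases n
    · simpa [h₀] using HasLeadingTerm.zero (K := K) 1
    · simpa [h₁] using HasLeadingTerm.C (1 : K)
    · exact h₂.congr (by norm_num) (by norm_num)
    · exact h₃.congr (by norm_num) (by norm_num)
    · exact h₄.congr (by norm_num) (by norm_num)
  obtain ⟨m, rfl | rfl⟩ := Nat.even_or_odd' n
  · obtain ⟨j, rfl⟩ : ∃ j, m = j + 3 := ⟨m - 3, by omega⟩
    have key := heven (j + 3) (by omega)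
    rw [show j + 3 - 1 = j + 2 by omega, show j + 3 - 2 = j + 1 by omega] at key
    rw [eq_div_of_mul_eq (h₂.ne_zero h2) ((mul_comm _ _).trans key)]
    have i₁ := ih (j + 1) (by omega)
    have i₂ := ih (j + 2) (by omega)
    have i₃ := ih (j + 3) (by omega)
    have i₄ := ih (j + 3 + 1) (by omega)
    have i₅ := ih (j + 3 + 2) (by omega)
    refine ((i₃.mul ((i₅.mul (i₂.pow 2)).sub
      ((i₁.mul (i₄.pow 2)).congr ?_ rfl))).div h₂ h2).congr ?_ ?_
    · push_cast; ring
    · push_cast; ring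
    · rw [div_eq_iff h2]
      push_cast
      rw [_root_.pow_succ _ (2 * _), pow_mul, neg_one_sq, one_pow]
      obtain h | h := neg_one_pow_eq_or K j <;> simp only [_root_.pow_add, h] <;> ring
  · obtain ⟨j, rfl⟩ : ∃ j, m = j + 2 := ⟨m - 2, by omega⟩
    rw [hodd (j + 2) (by omega), show j + 2 - 1 = j + 1 by omega]
    have i₁ := ih (j + 1) (by omega)
    have i₂ := ih (j + 2) (by omega)
    have i₃ := ih (j + 2 + 1) (by omega)
    have i₄ := ih (j + 2 + 2) (by omega)
    refine ((i₄.mul (i₂.pow 3)).sub ((i₁.mul (i₃.pow 3)).congr ?_ rfl)).congr ?_ ?_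
    · push_cast; ring
    · push_cast; ring
    · push_cast
      rw [add_assoc (2 * _), _root_.pow_add _ (2 * _), pow_mul, neg_one_sq, one_pow]
      obtain h | h := neg_one_pow_eq_or K j <;> simp only [_root_.pow_add, h] <;> ring

/-- **Leading term of division polynomials at infinity.**
Let `K` be a field of characteristic zero, `X Y : K((t))` Laurent series satisfying a Weierstrass
equation with `X = t⁻² + O(t⁻¹)` and `Y = -t⁻³ + O(t⁻²)`, and let `ψ n` denote the evaluation at
`(X, Y)` of the `n`-th division polynomial of the Weierstrass curve (characterized by the standard
initial values and recurrences).  Then for every `n ≥ 1`, `ψ n ≠ 0` and the Laurent series `ψ₂ₙ / ψₙ` is nonzero of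
order `-3n²` with leading coefficient `2·(-1)ⁿ`. -/
theorem division_polynomial_ratio_leading_term
    {K : Type*} [Field K] [CharZero K]
    (a₁ a₂ a₃ a₄ a₆ b₂ b₄ b₆ b₈ : K)
    (hb₂ : b₂ = a₁ ^ 2 + 4 * a₂)
    (hb₄ : b₄ = 2 * a₄ + a₁ * a₃)
    (hb₆ : b₆ = a₃ ^ 2 + 4 * a₆)
    (hb₈ : b₈ = a₁ ^ 2 * a₆ + 4 * a₂ * a₆ - a₁ * a₃ * a₄ + a₂ * a₃ ^ 2 - a₄ ^ 2)
    (T X Y : LaurentSeries K)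
    (hT : T = HahnSeries.single (1 : ℤ) (1 : K))
    (hW : Y ^ 2 + C a₁ * X * Y + C a₃ * Y
        = X ^ 3 + C a₂ * X ^ 2 + C a₄ * X + C a₆)
    (hX : ∃ f : PowerSeries K, T ^ 2 * X = 1 + T * (f : LaurentSeries K))
    (hY : ∃ g : PowerSeries K, T ^ 3 * Y = -1 + T * (g : LaurentSeries K))
    (ψ : ℕ → LaurentSeries K)
    (hψ₀ : ψ 0 = 0)
    (hψ₁ : ψ 1 = 1)
    (hψ₂ : ψ 2 = 2 * Y + C a₁ * X + C a₃)
    (hψ₃ : ψ 3 = 3 * X ^ 4 + C b₂ * X ^ 3 + 3 * C b₄ * X ^ 2 + 3 * C b₆ * X + C b₈)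
    (hψ₄ : ψ 4 = ψ 2 * (2 * X ^ 6 + C b₂ * X ^ 5 + 5 * C b₄ * X ^ 4 + 10 * C b₆ * X ^ 3
        + 10 * C b₈ * X ^ 2 + C (b₂ * b₈ - b₄ * b₆) * X + C (b₄ * b₈ - b₆ ^ 2)))
    (hψodd : ∀ m : ℕ, 2 ≤ m →
        ψ (2 * m + 1) = ψ (m + 2) * ψ m ^ 3 - ψ (m - 1) * ψ (m + 1) ^ 3)
    (hψeven : ∀ m : ℕ, 2 ≤ m →
        ψ 2 * ψ (2 * m) = ψ m * (ψ (m + 2) * ψ (m - 1) ^ 2 - ψ (m - 2) * ψ (m + 1) ^ 2)) :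
    ∀ n : ℕ, 1 ≤ n →
      ψ n ≠ 0 ∧ ψ (2 * n) / ψ n ≠ 0 ∧
      (ψ (2 * n) / ψ n).order = -3 * (n : ℤ) ^ 2 ∧
      (ψ (2 * n) / ψ n).coeff ((ψ (2 * n) / ψ n).order) = 2 * (-1 : K) ^ n := by
  subst hT
  have hX' : HasLeadingTerm X (-2) 1 := .of_single_mul (n := 2) (by simpa using hX)
  have hY' : HasLeadingTerm Y (-3) (-1) := .of_single_mul (n := 3) (by simpa using hY)
  have two : HasLeadingTerm (2 : LaurentSeries K) 0 2 := by
    simpa only [map_ofNat] using HasLeadingTerm.C (2 : K)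
  have three : HasLeadingTerm (3 : LaurentSeries K) 0 3 := by
    simpa only [map_ofNat] using HasLeadingTerm.C (3 : K)
  have h₂ : HasLeadingTerm (ψ 2) (-3) (-2) := by
    rw [hψ₂]
    exact (((two.mul hY').add (((HasLeadingTerm.C a₁).mul hX').of_lt (by norm_num))).add
      ((HasLeadingTerm.C a₃).of_lt (by norm_num))).congr (by norm_num) (by norm_num)
  have h₃ : HasLeadingTerm (ψ 3) (-8) 3 := by
    have := (((three.mul_add_C hX' (by norm_num) b₂).mul_add_C hX' (by norm_num)
      (3 * b₄)).mul_add_C hX' (by norm_num) (3 * b₆)).mul_add_C hX' (by norm_num) b₈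
    rw [hψ₃]
    convert this using 1
    · simp only [map_mul, map_ofNat]
      ring
    · norm_num
  have h₄ : HasLeadingTerm (ψ 4) (-15) (-4) := by
    have := h₂.mul ((((((two.mul_add_C hX' (by norm_num) b₂).mul_add_C hX' (by norm_num)
      (5 * b₄)).mul_add_C hX' (by norm_num) (10 * b₆)).mul_add_C hX' (by norm_num)
      (10 * b₈)).mul_add_C hX' (by norm_num) (b₂ * b₈ - b₄ * b₆)).mul_add_C hX' (by norm_num)
      (b₄ * b₈ - b₆ ^ 2))
    rw [hψ₄]
    convert this using 1
    · simp only [map_mul, map_ofNat]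
      ring
    · norm_num
    · norm_num
  have key := hasLeadingTerm_of_division_recurrence hψ₀ hψ₁ h₂ h₃ h₄ hψodd hψeven
  intro n hn
  have hn0 : (n : K) ≠ 0 := Nat.cast_ne_zero.2 (by omega)
  have hs : (-1 : K) ^ n ≠ 0 := pow_ne_zero _ (by norm_num)
  have hc : (-1 : K) ^ (n + 1) * n ≠ 0 := mul_ne_zero (pow_ne_zero _ (by norm_num)) hn0
  have hr : HasLeadingTerm (ψ (2 * n) / ψ n) (-3 * (n : ℤ) ^ 2) (2 * (-1) ^ n) := by
    refine ((key (2 * n)).div (key n) hc).congr (by push_cast; ring) ?_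
    rw [div_eq_iff hc]
    have hsq : (-1 : K) ^ n * (-1) ^ n = 1 := by rw [← mul_pow]; simp
    push_cast
    rw [pow_succ, pow_succ, pow_mul, neg_one_sq, one_pow]
    linear_combination 2 * (n : K) * hsq
  have hc' : 2 * (-1 : K) ^ n ≠ 0 := mul_ne_zero two_ne_zero hs
  refine ⟨(key n).ne_zero hc, hr.ne_zero hc', hr.order_eq hc', ?_⟩
  rw [hr.order_eq hc', hr.coeff_eq]
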